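/- Let (X,τ,d) be an extended metric topological space in which d = sup_n d_n for countably many τ×τ-continuous pseudo-distances d_n increasing to d, and suppose (X,d) is geodesic. Then the set Graph(G) = {((x,y),g) : d(x,y) < ∞, g a constant speed d-geodesic from x to y} is Borel in (X×X, τ×τ) × (C([0,1];X), uniform topology); consequently, for every Borel probability measure ν on D = {d < ∞} there is a ν-measurable map GeoSel: D → Geo(X,d) selecting, for each (x,y) ∈ D, a constant speed geodesic from x to y. -/

import Mathlib

open MeasureTheory ENNReal Set

noncomputable section

lemma exists_cont_inj_real : ∃ φ : (ℕ → ℕ) → ℝ, Continuous φ ∧ Function.Injective φ := by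
  refine ⟨fun x => (cantorSetHomeomorphNatToBool.symm
    (cantorSpaceHomeomorphNatToCantorSpace.symm (fun n k => decide (x n = k))) : ℝ), ?_, ?_⟩
  · refine continuous_subtype_val.comp (cantorSetHomeomorphNatToBool.symm.continuous.comp
      (cantorSpaceHomeomorphNatToCantorSpace.symm.continuous.comp ?_))
    refine continuous_pi fun n => continuous_pi fun k => ?_
    exact (continuous_of_discreteTopology (f := fun a : ℕ => decide (a = k))).comp
      (continuous_apply n)
  · intro x y h
    have h1 := cantorSpaceHomeomorphNatToCantorSpace.symm.injective
      (cantorSetHomeomorphNatToBool.symm.injective (Subtype.val_injective h))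
    funext n
    have h2 := congrFun (congrFun h1 n) (x n)
    simp only [decide_true] at h2
    exact (of_decide_eq_true h2.symm).symm

lemma exists_compact_approx {Z : Type*} [TopologicalSpace Z] [PolishSpace Z] [MeasurableSpace Z]
    [BorelSpace Z] (ν : Measure Z) [IsFiniteMeasure ν] (u : (ℕ → ℕ) → Z) (hu : Continuous u)
    (a : ℝ≥0∞) (ha : a < ν (range u)) :
    ∃ K : Set (ℕ → ℕ), IsCompact K ∧ a ≤ ν (u '' K) := by
  letI := TopologicalSpace.upgradeIsCompletelyMetrizable Z
  have step : ∀ (n : ℕ) (S : Set (ℕ → ℕ)), ∃ j : ℕ, a < ν (u '' S) →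
      a < ν (u '' (S ∩ {x | x n ≤ j})) := by
    intro n S
    by_cases h : a < ν (u '' S)
    · have hU : u '' S = ⋃ j : ℕ, u '' (S ∩ {x | x n ≤ j}) := by
        rw [← image_iUnion, ← inter_iUnion]
        congr 1
        ext x
        simp only [mem_inter_iff, mem_iUnion, mem_ofPred_eq]
        exact ⟨fun hx => ⟨hx, x n, le_rfl⟩, fun hx => hx.1⟩
      have hm : Monotone fun j : ℕ => u '' (S ∩ {x | x n ≤ j}) := by
        intro i j hij
        refine image_mono (inter_subset_inter_right _ ?_)
        intro x hx
        exact le_trans hx hij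
      rw [hU, hm.measure_iUnion] at h
      obtain ⟨j, hj⟩ := lt_iSup_iff.1 h
      exact ⟨j, fun _ => hj⟩
    · exact ⟨0, fun h' => absurd h' h⟩
  choose J hJ using step
  let F : ℕ → Set (ℕ → ℕ) := fun n =>
    Nat.rec univ (fun n S => S ∩ {x | x n ≤ J n S}) n
  have F0 : F 0 = univ := rfl
  have Fs : ∀ n, F (n + 1) = F n ∩ {x | x n ≤ J n (F n)} := fun n => rfl
  have hF : ∀ n, a < ν (u '' F n) := by
    intro n
    induction n with
    | zero => rw [F0, image_univ]; exact ha
    | succ n ih => rw [Fs]; exact hJ n _ ih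
  let m : ℕ → ℕ := fun n => J n (F n)
  have Fanti : Antitone F := antitone_nat_of_succ_le fun n => by
    rw [Fs]; exact inter_subset_left
  have Fm : ∀ n x, x ∈ F n → ∀ i < n, x i ≤ m i := by
    intro n x hx i hi
    have := Fanti (Nat.succ_le_of_lt hi) hx
    rw [Nat.succ_eq_add_one, Fs] at this
    exact this.2
  refine ⟨Icc 0 m, isCompact_Icc, ?_⟩
  have hsub : (⋂ n, closure (u '' F n)) ⊆ u '' Icc 0 m := by
    intro z hz
    have h1 : ∀ n : ℕ, ∃ x ∈ F n, dist z (u x) < 1 / ((n : ℝ) + 1) := by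
      intro n
      obtain ⟨_, ⟨x, hx, rfl⟩, h⟩ := Metric.mem_closure_iff.1 (mem_iInter.1 hz n)
        (1 / ((n : ℝ) + 1)) (by positivity)
      exact ⟨x, hx, h⟩
    choose x hxF hxd using h1
    have hK : ∀ n, (fun i => min (x n i) (m i)) ∈ Icc (0 : ℕ → ℕ) m := fun n =>
      ⟨fun i => Nat.zero_le _, fun i => min_le_right _ _⟩
    obtain ⟨y, hy, φ, hφ, hlim⟩ := (isCompact_Icc (a := (0 : ℕ → ℕ)) (b := m)).tendsto_subseq hK
    have hx : Filter.Tendsto (fun n => x (φ n)) Filter.atTop (nhds y) := by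
      rw [tendsto_pi_nhds] at hlim ⊢
      intro i
      refine (hlim i).congr' ?_
      filter_upwards [Filter.eventually_gt_atTop i] with n hn
      exact min_eq_left (Fm _ _ (hxF (φ n)) i (lt_of_lt_of_le hn (hφ.id_le n)))
    have h2 : Filter.Tendsto (fun n => u (x n)) Filter.atTop (nhds z) := by
      rw [tendsto_iff_dist_tendsto_zero]
      refine squeeze_zero (fun _ => dist_nonneg) (fun n => ?_)
        tendsto_one_div_add_atTop_nhds_zero_nat
      rw [dist_comm]; exact (hxd n).le
    exact ⟨y, hy, tendsto_nhds_unique ((hu.tendsto y).comp hx) (h2.comp hφ.tendsto_atTop)⟩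
  refine le_trans ?_ (measure_mono hsub)
  have hanti : Antitone fun n => closure (u '' F n) := fun i j hij =>
    closure_mono (image_mono (Fanti hij))
  refine ge_of_tendsto' (tendsto_measure_iInter_atTop
    (fun n => isClosed_closure.measurableSet.nullMeasurableSet) hanti
    ⟨0, measure_ne_top _ _⟩) fun n => ?_
  exact (hF n).le.trans (measure_mono subset_closure)

lemma exists_section_compact {Z : Type*} [TopologicalSpace Z] [T2Space Z] [MeasurableSpace Z]
    [BorelSpace Z] (u : (ℕ → ℕ) → Z) (hu : Continuous u) (K : Set (ℕ → ℕ)) (hK : IsCompact K) :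
    ∃ σ : Z → (ℕ → ℕ), Measurable σ ∧ ∀ z ∈ u '' K, u (σ z) = z := by
  classical
  obtain ⟨φ, hφ, hinj⟩ := exists_cont_inj_real
  have hmin : ∀ z : Z, ∃ x : ℕ → ℕ, (z ∈ u '' K → x ∈ K ∧ u x = z ∧
      ∀ y ∈ K, u y = z → φ x ≤ φ y) ∧ (z ∉ u '' K → x = 0) := by
    intro z
    by_cases hz : z ∈ u '' K
    · have hc : IsCompact (K ∩ u ⁻¹' {z}) := hK.inter_right (isClosed_singleton.preimage hu)
      have hne : (K ∩ u ⁻¹' {z}).Nonempty := by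
        obtain ⟨x, hx, h⟩ := hz
        exact ⟨x, hx, h⟩
      obtain ⟨x, hx, h⟩ := hc.exists_isMinOn hne hφ.continuousOn
      exact ⟨x, fun _ => ⟨hx.1, hx.2, fun y hy hyz => h ⟨hy, hyz⟩⟩, fun h' => absurd hz h'⟩
    · exact ⟨0, fun h => absurd h hz, fun _ => rfl⟩
  choose σ hσ hσ0 using hmin
  refine ⟨σ, ?_, fun z hz => (hσ z hz).2.1⟩
  have hA : MeasurableSet (u '' K) := (hK.image hu).measurableSet
  have hm : Measurable fun z => φ (σ z) := by
    refine measurable_of_Iic fun c => ?_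
    have : (fun z => φ (σ z)) ⁻¹' Iic c =
        u '' (K ∩ φ ⁻¹' Iic c) ∪ ((u '' K)ᶜ ∩ {_z | φ 0 ≤ c}) := by
      ext z
      by_cases hz : z ∈ u '' K
      · have h := hσ z hz
        simp only [mem_preimage, mem_Iic, mem_union, mem_inter_iff, mem_compl_iff, hz,
          not_true_eq_false, false_and, or_false]
        constructor
        · intro hc
          exact ⟨σ z, ⟨h.1, hc⟩, h.2.1⟩
        · rintro ⟨y, ⟨hy, hyc⟩, hyz⟩
          exact (h.2.2 y hy hyz).trans hyc
      · have h2 : z ∉ u '' (K ∩ φ ⁻¹' Iic c) := fun h => hz (image_mono inter_subset_left h)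
        simp only [mem_preimage, mem_Iic, mem_union, mem_inter_iff, mem_compl_iff, hz, h2,
          not_false_eq_true, true_and, false_or, hσ0 z hz, mem_ofPred_eq]
    rw [this]
    exact ((hK.inter_right (isClosed_Iic.preimage hφ)).image hu).measurableSet.union
      (hA.compl.inter (MeasurableSet.const _))
  exact ((hφ.measurableEmbedding hinj).measurable_comp_iff).1 hm

lemma exists_ae_section {Z : Type*} [TopologicalSpace Z] [PolishSpace Z] [MeasurableSpace Z]
    [BorelSpace Z] (ν : Measure Z) [IsProbabilityMeasure ν] (u : (ℕ → ℕ) → Z) (hu : Continuous u)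
    (hr : ν (range u) = 1) :
    ∃ σ : Z → (ℕ → ℕ), AEMeasurable σ ν ∧ ∀ z ∈ range u, u (σ z) = z := by
  classical
  have h1 : ∀ n : ℕ, ∃ K : Set (ℕ → ℕ), IsCompact K ∧ 1 - ((n : ℝ≥0∞) + 1)⁻¹ ≤ ν (u '' K) := by
    intro n
    refine exists_compact_approx ν u hu _ ?_
    rw [hr]
    exact ENNReal.sub_lt_self one_ne_top one_ne_zero (ENNReal.inv_ne_zero.2 (by finiteness))
  choose K hK hKν using h1
  have h2 := fun n => exists_section_compact u hu (K n) (hK n)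
  choose s hs hsu using h2
  have hAm : ∀ n, MeasurableSet (u '' K n) := fun n => ((hK n).image hu).measurableSet
  set A : Set Z := ⋃ n, u '' K n with hAdef
  have hA : MeasurableSet A := MeasurableSet.iUnion hAm
  have hA0 : ν Aᶜ = 0 := by
    rw [prob_compl_eq_zero_iff hA]
    refine le_antisymm prob_le_one ?_
    have hlim : Filter.Tendsto (fun n : ℕ => 1 - ((n : ℝ≥0∞) + 1)⁻¹) Filter.atTop
        (nhds (1 - 0)) := by
      refine ENNReal.Tendsto.sub tendsto_const_nhds ?_ (Or.inl one_ne_top)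
      have := (Filter.tendsto_add_atTop_iff_nat 1).2 ENNReal.tendsto_inv_nat_nhds_zero
      simpa using this
    rw [tsub_zero] at hlim
    exact le_of_tendsto' hlim fun n => (hKν n).trans (measure_mono (subset_iUnion (fun n => u '' K n) n))
  let p : Z → ℕ → Prop := fun z n => z ∈ u '' K n ∪ Aᶜ
  have hp : ∀ z, ∃ n, p z n := by
    intro z
    by_cases hz : z ∈ A
    · obtain ⟨n, hn⟩ := mem_iUnion.1 hz
      exact ⟨n, Or.inl hn⟩
    · exact ⟨0, Or.inr hz⟩
  have hmeas : Measurable fun z => s (Nat.find (hp z)) z :=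
    Measurable.find (f := s) (p := fun n z => p z n) hs (fun n => (hAm n).union hA.compl) hp
  have hch : ∀ z : Z, ∃ x : ℕ → ℕ, z ∈ range u → u x = z := by
    intro z
    by_cases hz : z ∈ range u
    · obtain ⟨x, hx⟩ := hz
      exact ⟨x, fun _ => hx⟩
    · exact ⟨0, fun h => absurd h hz⟩
  choose c hc using hch
  refine ⟨fun z => if z ∈ A then s (Nat.find (hp z)) z else c z, ⟨_, hmeas, ?_⟩, ?_⟩
  · have : ∀ᵐ z ∂ν, z ∈ A := hA0
    filter_upwards [this] with z hz
    simp [hz]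
  · intro z hz
    by_cases hzA : z ∈ A
    · simp only [hzA, if_true]
      have := Nat.find_spec (hp z)
      rcases this with h | h
      · exact hsu _ _ h
      · exact absurd hzA h
    · simp only [hzA, if_false]
      exact hc z hz

lemma polish_cmap {X : Type*} [TopologicalSpace X] [PolishSpace X] :
    PolishSpace C(Set.Icc (0:ℝ) 1, X) := by
  letI := TopologicalSpace.upgradeIsCompletelyMetrizable X
  infer_instance

/-- Measurable selection of geodesics in an extended metric topological
space.  Let `(X,τ)` be Polish and `d = sup_n d_n` for countably many `τ×τ`-continuous
pseudo-distances `d_n` increasing to `d`, and suppose `(X,d)` is geodesic.  Then the graph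
`Graph(G) = {((x,y),g) : d(x,y) < ∞, g a constant speed d-geodesic from x to y}` is Borel in
`(X×X) × C([0,1];X)` (with the uniform/compact-open topology), and for every Borel
probability measure `ν` concentrated on `D = {d < ∞}` there is a `ν`-measurable map
selecting, for each `(x,y) ∈ D`, a constant speed geodesic from `x` to `y`. -/
theorem geodesic_measurable_selection
    {X : Type*} [TopologicalSpace X] [PolishSpace X] [MeasurableSpace X] [BorelSpace X]
    (d : X → X → ℝ≥0∞) (dn : ℕ → X → X → ℝ≥0∞)
    (hcont : ∀ n, Continuous fun p : X × X => dn n p.1 p.2)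
    (hfin : ∀ n x y, dn n x y ≠ ⊤)
    (hsymm : ∀ n x y, dn n x y = dn n y x)
    (hzero : ∀ n x, dn n x x = 0)
    (htri : ∀ n x y z, dn n x z ≤ dn n x y + dn n y z)
    (hmono : ∀ n x y, dn n x y ≤ dn (n + 1) x y)
    (hsup : ∀ x y, d x y = ⨆ n, dn n x y)
    (hdist : ∀ x y, d x y = 0 → x = y)
    (hgeo : ∀ x y : X, d x y ≠ ⊤ → ∃ g : C(Set.Icc (0:ℝ) 1, X),
      g ⟨0, by norm_num⟩ = x ∧ g ⟨1, by norm_num⟩ = y ∧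
      ∀ s t : Set.Icc (0:ℝ) 1,
        d (g s) (g t) = ENNReal.ofReal |s.1 - t.1| * d x y) :
    MeasurableSet[borel ((X × X) × C(Set.Icc (0:ℝ) 1, X))]
      {q : (X × X) × C(Set.Icc (0:ℝ) 1, X) |
        d q.1.1 q.1.2 ≠ ⊤ ∧
        q.2 ⟨0, by norm_num⟩ = q.1.1 ∧ q.2 ⟨1, by norm_num⟩ = q.1.2 ∧
        ∀ s t : Set.Icc (0:ℝ) 1,
          d (q.2 s) (q.2 t) = ENNReal.ofReal |s.1 - t.1| * d q.1.1 q.1.2} ∧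
    ∀ ν : Measure (X × X), IsProbabilityMeasure ν →
      ν {p : X × X | d p.1 p.2 = ⊤} = 0 →
      ∃ sel : X × X → C(Set.Icc (0:ℝ) 1, X),
        (∀ p : X × X, d p.1 p.2 ≠ ⊤ →
          sel p ⟨0, by norm_num⟩ = p.1 ∧ sel p ⟨1, by norm_num⟩ = p.2 ∧
          ∀ s t : Set.Icc (0:ℝ) 1,
            d (sel p s) (sel p t) = ENNReal.ofReal |s.1 - t.1| * d p.1 p.2) ∧
        ∀ S : Set C(Set.Icc (0:ℝ) 1, X), MeasurableSet[borel _] S →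
          NullMeasurableSet (sel ⁻¹' S) ν := by
  haveI : PolishSpace C(Set.Icc (0:ℝ) 1, X) := polish_cmap
  letI : MeasurableSpace C(Set.Icc (0:ℝ) 1, X) := borel _
  haveI : BorelSpace C(Set.Icc (0:ℝ) 1, X) := ⟨rfl⟩
  have hd_symm : ∀ x y, d x y = d y x := fun x y => by
    rw [hsup, hsup]; exact iSup_congr fun n => hsymm n x y
  have hd_tri : ∀ x y z, d x z ≤ d x y + d y z := by
    intro x y z
    rw [hsup x z]
    refine iSup_le fun n => (htri n x y z).trans (add_le_add ?_ ?_)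
    · rw [hsup]; exact le_iSup (fun n => dn n x y) n
    · rw [hsup]; exact le_iSup (fun n => dn n y z) n
  have hd_meas : Measurable fun p : X × X => d p.1 p.2 := by
    simp only [hsup]
    exact Measurable.iSup fun n => (hcont n).measurable
  have hev : ∀ s : Set.Icc (0:ℝ) 1,
      Measurable fun q : (X × X) × C(Set.Icc (0:ℝ) 1, X) => q.2 s := fun s =>
    ((continuous_eval_const s).comp continuous_snd).measurable
  have hB : MeasurableSet {q : (X × X) × C(Set.Icc (0:ℝ) 1, X) |
        d q.1.1 q.1.2 ≠ ⊤ ∧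
        q.2 ⟨0, by norm_num⟩ = q.1.1 ∧ q.2 ⟨1, by norm_num⟩ = q.1.2 ∧
        ∀ s t : Set.Icc (0:ℝ) 1,
          d (q.2 s) (q.2 t) = ENNReal.ofReal |s.1 - t.1| * d q.1.1 q.1.2} := by
    obtain ⟨T, hTc, hTd⟩ := TopologicalSpace.exists_countable_dense (Set.Icc (0:ℝ) 1)
    have heq : {q : (X × X) × C(Set.Icc (0:ℝ) 1, X) |
        d q.1.1 q.1.2 ≠ ⊤ ∧
        q.2 ⟨0, by norm_num⟩ = q.1.1 ∧ q.2 ⟨1, by norm_num⟩ = q.1.2 ∧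
        ∀ s t : Set.Icc (0:ℝ) 1,
          d (q.2 s) (q.2 t) = ENNReal.ofReal |s.1 - t.1| * d q.1.1 q.1.2} =
        {q | d q.1.1 q.1.2 ≠ ⊤} ∩ ({q | q.2 ⟨0, by norm_num⟩ = q.1.1} ∩
        ({q | q.2 ⟨1, by norm_num⟩ = q.1.2} ∩ ⋂ s ∈ T, ⋂ t ∈ T,
        {q | d (q.2 s) (q.2 t) ≤ ENNReal.ofReal |s.1 - t.1| * d q.1.1 q.1.2})) := by
      ext ⟨⟨x, y⟩, g⟩
      simp only [mem_ofPred_eq, mem_inter_iff, mem_iInter]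
      constructor
      · rintro ⟨h1, h2, h3, h4⟩
        exact ⟨h1, h2, h3, fun s _ t _ => (h4 s t).le⟩
      · rintro ⟨h1, h2, h3, h4⟩
        refine ⟨h1, h2, h3, ?_⟩
        have hle : ∀ s t : Set.Icc (0:ℝ) 1,
            d (g s) (g t) ≤ ENNReal.ofReal |s.1 - t.1| * d x y := by
          intro s t
          rw [hsup (g s)]
          refine iSup_le fun n => ?_
          have hcl : IsClosed {p : Set.Icc (0:ℝ) 1 × Set.Icc (0:ℝ) 1 |
              dn n (g p.1) (g p.2) ≤ ENNReal.ofReal |p.1.1 - p.2.1| * d x y} := by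
            refine isClosed_le ?_ ?_
            · exact (hcont n).comp
                ((g.continuous.comp continuous_fst).prodMk (g.continuous.comp continuous_snd))
            · refine (ENNReal.continuous_mul_const h1).comp
                (ENNReal.continuous_ofReal.comp ?_)
              fun_prop
          have hsubset : T ×ˢ T ⊆ {p : Set.Icc (0:ℝ) 1 × Set.Icc (0:ℝ) 1 |
              dn n (g p.1) (g p.2) ≤ ENNReal.ofReal |p.1.1 - p.2.1| * d x y} := by
            rintro ⟨s, t⟩ ⟨hs, ht⟩
            refine le_trans ?_ (h4 s hs t ht)
            rw [hsup]; exact le_iSup (fun n => dn n (g s) (g t)) n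
          have := closure_minimal hsubset hcl
          rw [(hTd.prod hTd).closure_eq] at this
          exact this (mem_univ (s, t))
        have hlt : ∀ s t : Set.Icc (0:ℝ) 1, s.1 ≤ t.1 →
            d (g s) (g t) = ENNReal.ofReal |s.1 - t.1| * d x y := by
          intro s t hst
          refine le_antisymm (hle s t) ?_
          have ha := hle ⟨0, by norm_num⟩ s
          have hb := hle t ⟨1, by norm_num⟩
          rw [h2] at ha
          rw [h3] at hb
          have e1 : |(0:ℝ) - s.1| = s.1 := by
            rw [zero_sub, abs_neg, abs_of_nonneg s.2.1]
          have e2 : |t.1 - (1:ℝ)| = 1 - t.1 := by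
            rw [abs_sub_comm, abs_of_nonneg (sub_nonneg.2 t.2.2)]
          have e3 : |s.1 - t.1| = t.1 - s.1 := by
            rw [abs_sub_comm, abs_of_nonneg (sub_nonneg.2 hst)]
          simp only [e1] at ha
          simp only [e2] at hb
          rw [e3]
          have hs0 : 0 ≤ s.1 := s.2.1
          have ht1 : 0 ≤ 1 - t.1 := sub_nonneg.2 t.2.2
          have hst0 : 0 ≤ t.1 - s.1 := sub_nonneg.2 hst
          have hone : ENNReal.ofReal s.1 * d x y + ENNReal.ofReal (1 - t.1) * d x y
              + ENNReal.ofReal (t.1 - s.1) * d x y = d x y := by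
            rw [← add_mul, ← add_mul, ← ENNReal.ofReal_add hs0 ht1,
              ← ENNReal.ofReal_add (add_nonneg hs0 ht1) hst0]
            have : s.1 + (1 - t.1) + (t.1 - s.1) = 1 := by ring
            rw [this, ENNReal.ofReal_one, one_mul]
          have htot : d x y ≤ ENNReal.ofReal s.1 * d x y + ENNReal.ofReal (1 - t.1) * d x y
              + d (g s) (g t) := by
            calc d x y ≤ d x (g s) + d (g s) y := hd_tri _ _ _
              _ ≤ d x (g s) + (d (g s) (g t) + d (g t) y) := by gcongr; exact hd_tri _ _ _
              _ ≤ ENNReal.ofReal s.1 * d x y +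
                  (d (g s) (g t) + ENNReal.ofReal (1 - t.1) * d x y) := by gcongr
              _ = _ := by ring
          have hne : ENNReal.ofReal s.1 * d x y + ENNReal.ofReal (1 - t.1) * d x y ≠ ⊤ := by
            finiteness
          refine (ENNReal.add_le_add_iff_left hne).1 ?_
          rw [hone]
          exact htot
        intro s t
        rcases le_total s.1 t.1 with h | h
        · exact hlt s t h
        · rw [hd_symm, abs_sub_comm]; exact hlt t s h
    rw [heq]
    have hdq : Measurable fun q : (X × X) × C(Set.Icc (0:ℝ) 1, X) => d q.1.1 q.1.2 :=
      hd_meas.comp measurable_fst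
    refine MeasurableSet.inter ?_ (MeasurableSet.inter ?_ (MeasurableSet.inter ?_ ?_))
    · exact (hdq (measurableSet_singleton ⊤)).compl
    · exact measurableSet_eq_fun (hev _) (measurable_fst.comp measurable_fst)
    · exact measurableSet_eq_fun (hev _) (measurable_snd.comp measurable_fst)
    · refine MeasurableSet.biInter hTc fun s _ => MeasurableSet.biInter hTc fun t _ => ?_
      exact measurableSet_le (hd_meas.comp ((hev s).prodMk (hev t))) (hdq.const_mul _)
  refine ⟨?_, ?_⟩
  · have hb : borel ((X × X) × C(Set.Icc (0:ℝ) 1, X)) =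
        (inferInstance : MeasurableSpace ((X × X) × C(Set.Icc (0:ℝ) 1, X))) :=
      (BorelSpace.measurable_eq).symm
    rw [hb]
    exact hB
  intro ν hν hν0
  have han := hB.analyticSet
  rw [AnalyticSet] at han
  rcases han with hemp | ⟨f, hf, hfr⟩
  · exfalso
    have : {p : X × X | d p.1 p.2 = ⊤} = univ := by
      refine eq_univ_of_forall fun p => ?_
      by_contra hp
      obtain ⟨g, hg⟩ := hgeo p.1 p.2 hp
      have : (p, g) ∈ (∅ : Set ((X × X) × C(Set.Icc (0:ℝ) 1, X))) := by
        rw [← hemp]; exact ⟨hp, hg⟩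
      exact this
    rw [this, measure_univ] at hν0
    exact one_ne_zero hν0
  have hmem : ∀ x, f x ∈ range f := fun x => mem_range_self x
  have hru : range (fun x => (f x).1) = {p : X × X | d p.1 p.2 ≠ ⊤} := by
    ext p
    constructor
    · rintro ⟨x, rfl⟩
      have := hmem x
      rw [hfr] at this
      exact this.1
    · intro hp
      obtain ⟨g, hg⟩ := hgeo p.1 p.2 hp
      have : (p, g) ∈ range f := by
        rw [hfr]; exact ⟨hp, hg⟩
      obtain ⟨x, hx⟩ := this
      exact ⟨x, by simp only [hx]⟩
  have hr1 : ν (range (fun x => (f x).1)) = 1 := by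
    rw [hru]
    have hm : MeasurableSet {p : X × X | d p.1 p.2 = ⊤} := hd_meas (measurableSet_singleton ⊤)
    exact (prob_compl_eq_one_iff hm).2 hν0
  obtain ⟨σ, hσ, hσu⟩ := exists_ae_section ν (fun x => (f x).1) (continuous_fst.comp hf) hr1
  refine ⟨fun p => (f (σ p)).2, ?_, ?_⟩
  · intro p hp
    have h1 : (f (σ p)).1 = p := hσu p (by rw [hru]; exact hp)
    have h2 := hmem (σ p)
    rw [hfr] at h2
    have h3 := h2.2
    rw [h1] at h3
    exact h3
  · intro S hS
    have : AEMeasurable (fun p => (f (σ p)).2) ν :=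
      (continuous_snd.comp hf).measurable.comp_aemeasurable hσ
    exact this.nullMeasurableSet_preimage hS
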